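/- Let V be a finite-dimensional K-vector space and F an antitone, exhaustive and separated filtration on V. Then there is a K-linear isomorphism between the quotient R(V,F) / (x • R(V,F)) (where x • R(V,F) denotes Ideal.span{x} • R(V,F)) and the direct sum over i ∈ ℤ of the graded pieces F(i)/F(i+1), where F(i)/F(i+1) denotes the quotient of the module F(i) by the submodule of F(i) pulled back from F(i+1). -/

import Mathlib

open Polynomial LaurentPolynomial TensorProduct DirectSum

noncomputable instance (K : Type*) [Field K] :
    IsScalarTower K (Polynomial K) (LaurentPolynomial K) :=
  IsScalarTower.of_algebraMap_eq fun c => by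
    simp [LaurentPolynomial.algebraMap_eq_toLaurent]

noncomputable instance (K : Type*) [Field K] :
    SMulCommClass K (Polynomial K) (LaurentPolynomial K) :=
  IsScalarTower.to_smulCommClass

noncomputable instance (priority := 1100) (K : Type*) [Field K] (V : Type*) [AddCommGroup V]
    [Module K V] : AddCommGroup (LaurentPolynomial K ⊗[K] V) :=
  TensorProduct.addCommGroup

/-- The `K`-linear map `μ m : v ↦ x^m ⊗ v` from `V` to `K[x,x⁻¹] ⊗[K] V`. -/
noncomputable def mu (K : Type*) [Field K] (V : Type*) [AddCommGroup V] [Module K V] (m : ℤ) :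
    V →ₗ[K] LaurentPolynomial K ⊗[K] V :=
  TensorProduct.mk K (LaurentPolynomial K) V (LaurentPolynomial.T m)

/-- The Rees module of a filtration `F`: the `K[x]`-submodule of `K[x,x⁻¹] ⊗[K] V`
generated by the elements `x^(-i) ⊗ v` with `i : ℤ` and `v ∈ F i`. -/
noncomputable def ReesModule (K : Type*) [Field K] (V : Type*) [AddCommGroup V] [Module K V]
    (F : ℤ → Submodule K V) : Submodule (Polynomial K) (LaurentPolynomial K ⊗[K] V) :=
  Submodule.span (Polynomial K)
    {z | ∃ (i : ℤ) (v : V), v ∈ F i ∧ z = LaurentPolynomial.T (-i) ⊗ₜ[K] v}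

/-- The `K`-linear map extracting from an element of `K[x,x⁻¹] ⊗[K] V` its coefficient
at `x^(-i)`. -/
noncomputable def tensorCoeff (K : Type*) [Field K] (V : Type*) [AddCommGroup V] [Module K V]
    (i : ℤ) : LaurentPolynomial K ⊗[K] V →ₗ[K] V :=
  TensorProduct.lift (LinearMap.lsmul K V ∘ₗ
    Finsupp.lapply (-i) ∘ₗ (AddMonoidAlgebra.coeffLinearEquiv K).toLinearMap)

section Rees

variable (K : Type*) [Field K] (V : Type*) [AddCommGroup V] [Module K V]

lemma tensorCoeff_T_tmul (i m : ℤ) (v : V) :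
    tensorCoeff K V i (LaurentPolynomial.T m ⊗ₜ[K] v) = if m = -i then v else 0 := by
  have h : (LaurentPolynomial.T m : LaurentPolynomial K).coeff (-i) = if m = -i then 1 else 0 :=
    Finsupp.single_apply
  change (LaurentPolynomial.T m : LaurentPolynomial K).coeff (-i) • v = _
  rw [h, ite_smul, one_smul, zero_smul]

lemma X_smul_T_tmul (m : ℤ) (v : V) :
    (Polynomial.X : Polynomial K) • (LaurentPolynomial.T m ⊗ₜ[K] v : LaurentPolynomial K ⊗[K] V) =
      LaurentPolynomial.T (m + 1) ⊗ₜ[K] v := by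
  rw [TensorProduct.smul_tmul', Algebra.smul_def, LaurentPolynomial.algebraMap_eq_toLaurent,
    Polynomial.toLaurent_X, ← LaurentPolynomial.T_add, add_comm]

lemma tensorCoeff_X_smul (i : ℤ) (z : LaurentPolynomial K ⊗[K] V) :
    tensorCoeff K V i ((Polynomial.X : Polynomial K) • z) = tensorCoeff K V (i + 1) z := by
  induction z with
  | zero => simp
  | add a b ha hb => rw [smul_add, map_add, map_add, ha, hb]
  | tmul f v =>
    induction f using LaurentPolynomial.induction_on' with
    | add p q hp hq => rw [TensorProduct.add_tmul, smul_add, map_add, map_add, hp, hq]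
    | C_mul_T n a =>
      rw [← LaurentPolynomial.smul_eq_C_mul, ← TensorProduct.smul_tmul', smul_comm, (tensorCoeff K V i).map_smul,
        (tensorCoeff K V (i + 1)).map_smul, X_smul_T_tmul, tensorCoeff_T_tmul, tensorCoeff_T_tmul]
      congr 2
      exact propext ⟨fun h => by lia, fun h => by lia⟩

variable {V}

/-- A `K`-subspace stable under `X` is stable under `K[x]`. -/
lemma polynomial_smul_mem_of_X_smul_mem {M : Type*} [AddCommGroup M] [Module K M]
    [Module (Polynomial K) M] [IsScalarTower K (Polynomial K) M] (N : Submodule K M)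
    (hN : ∀ z ∈ N, (Polynomial.X : Polynomial K) • z ∈ N) (p : Polynomial K) {z : M}
    (hz : z ∈ N) : p • z ∈ N := by
  induction p using Polynomial.induction_on' with
  | add p q hp hq => rw [add_smul]; exact N.add_mem hp hq
  | monomial n a =>
    rw [← mul_one a, ← smul_eq_mul, ← Polynomial.smul_monomial, smul_assoc,
      Polynomial.monomial_one_right_eq_X_pow]
    refine N.smul_mem a ?_
    induction n with
    | zero => simpa using hz
    | succ n ih => rw [pow_succ', mul_smul]; exact hN _ ih

variable (V) (F : ℤ → Submodule K V)

/-- For an antitone family, the Rees module is already the `K`-span of its generators. -/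
lemma reesModule_restrictScalars_eq_span (hF : Antitone F) :
    (ReesModule K V F).restrictScalars K = Submodule.span K
      {z | ∃ (i : ℤ) (v : V), v ∈ F i ∧ z = LaurentPolynomial.T (-i) ⊗ₜ[K] v} := by
  apply le_antisymm
  · intro z hz
    rw [Submodule.restrictScalars_mem, ReesModule] at hz
    induction hz using Submodule.span_induction with
    | mem z h => exact Submodule.subset_span h
    | zero => exact Submodule.zero_mem _
    | add a b _ _ ha hb => exact Submodule.add_mem _ ha hb
    | smul p z _ hz =>
      refine polynomial_smul_mem_of_X_smul_mem K _ (fun z hz => ?_) p hz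
      induction hz using Submodule.span_induction with
      | mem z h =>
        obtain ⟨i, v, hv, rfl⟩ := h
        refine Submodule.subset_span ⟨i - 1, v, hF (by lia) hv, ?_⟩
        rw [X_smul_T_tmul, neg_sub, sub_eq_add_neg, add_comm]
      | zero => rw [smul_zero]; exact Submodule.zero_mem _
      | add a b _ _ ha hb => rw [smul_add]; exact Submodule.add_mem _ ha hb
      | smul c z _ hz => rw [smul_comm]; exact Submodule.smul_mem _ c hz
  · exact Submodule.span_le_restrictScalars K (Polynomial K) _

variable {V F}

lemma T_tmul_mem_reesModule {i : ℤ} {v : V} (hv : v ∈ F i) :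
    LaurentPolynomial.T (-i) ⊗ₜ[K] v ∈ ReesModule K V F :=
  Submodule.subset_span ⟨i, v, hv, rfl⟩

lemma tensorCoeff_mem_of_mem_reesModule (hF : Antitone F) (i : ℤ)
    {z : LaurentPolynomial K ⊗[K] V} (hz : z ∈ ReesModule K V F) :
    tensorCoeff K V i z ∈ F i := by
  suffices h : (ReesModule K V F).restrictScalars K ≤ (F i).comap (tensorCoeff K V i) from h hz
  rw [reesModule_restrictScalars_eq_span K V F hF, Submodule.span_le]
  rintro _ ⟨j, v, hv, rfl⟩
  rw [SetLike.mem_coe, Submodule.mem_comap, tensorCoeff_T_tmul]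
  split_ifs with h
  · rwa [← neg_injective h]
  · exact zero_mem _

lemma mem_span_X_smul_reesModule {z : LaurentPolynomial K ⊗[K] V} :
    z ∈ Ideal.span {(Polynomial.X : Polynomial K)} • ReesModule K V F ↔
      ∃ y ∈ ReesModule K V F, (Polynomial.X : Polynomial K) • y = z := by
  rw [Submodule.ideal_span_singleton_smul]
  exact Iff.rfl

lemma tensorCoeff_mem_of_mem_X_smul (hF : Antitone F) (i : ℤ) {z : LaurentPolynomial K ⊗[K] V}
    (hz : z ∈ Ideal.span {(Polynomial.X : Polynomial K)} • ReesModule K V F) :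
    tensorCoeff K V i z ∈ F (i + 1) := by
  obtain ⟨y, hy, rfl⟩ := (mem_span_X_smul_reesModule K).1 hz
  rw [tensorCoeff_X_smul]
  exact tensorCoeff_mem_of_mem_reesModule K hF (i + 1) hy

lemma T_tmul_mem_X_smul {i : ℤ} {v : V} (hv : v ∈ F (i + 1)) :
    LaurentPolynomial.T (-i) ⊗ₜ[K] v ∈
      Ideal.span {(Polynomial.X : Polynomial K)} • ReesModule K V F := by
  refine (mem_span_X_smul_reesModule K).2 ⟨_, T_tmul_mem_reesModule K hv, ?_⟩
  rw [X_smul_T_tmul]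
  congr 2
  ring

variable (V F)

/-- The submodule `x • R(V,F)` of the Rees module, over `K`. -/
noncomputable abbrev reesXSmul : Submodule K ↥((ReesModule K V F).restrictScalars K) :=
  Submodule.comap ((ReesModule K V F).restrictScalars K).subtype
    ((Ideal.span {(Polynomial.X : Polynomial K)} • ReesModule K V F).restrictScalars K)

/-- The map `F i → R(V,F)`, `v ↦ x^(-i) ⊗ v`. -/
noncomputable def toRees (i : ℤ) : ↥(F i) →ₗ[K] ↥((ReesModule K V F).restrictScalars K) :=
  LinearMap.codRestrict _ (mu K V (-i) ∘ₗ (F i).subtype)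
    fun v => T_tmul_mem_reesModule K v.2

/-- The map from the direct sum of the graded pieces to `R(V,F) / (x • R(V,F))` induced by
`v ↦ x^(-i) ⊗ v`. -/
noncomputable def gradedToReesQuotient :
    (⨁ i : ℤ, (↥(F i) ⧸ Submodule.comap (F i).subtype (F (i + 1)))) →ₗ[K]
      ↥((ReesModule K V F).restrictScalars K) ⧸ reesXSmul K V F :=
  DirectSum.toModule K ℤ _ fun i =>
    Submodule.mapQ _ (reesXSmul K V F) (toRees K V F i) fun _ hv => T_tmul_mem_X_smul K hv

/-- The map `R(V,F) / (x • R(V,F)) → F i / F (i+1)` induced by taking the coefficient of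
`x^(-i)`. -/
noncomputable def reesQuotientCoeff (hF : Antitone F) (i : ℤ) :
    (↥((ReesModule K V F).restrictScalars K) ⧸ reesXSmul K V F) →ₗ[K]
      ↥(F i) ⧸ Submodule.comap (F i).subtype (F (i + 1)) :=
  Submodule.mapQ (reesXSmul K V F) _
    (LinearMap.restrict (tensorCoeff K V i)
      fun _ hz => tensorCoeff_mem_of_mem_reesModule K hF i hz)
    fun _ hz => tensorCoeff_mem_of_mem_X_smul K hF i hz

lemma reesQuotientCoeff_gradedToReesQuotient (hF : Antitone F) (i : ℤ)
    (a : ⨁ i : ℤ, (↥(F i) ⧸ Submodule.comap (F i).subtype (F (i + 1)))) :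
    reesQuotientCoeff K V F hF i (gradedToReesQuotient K V F a) = a i := by
  induction a using DirectSum.induction_on with
  | zero => simp
  | add a b ha hb => rw [map_add, map_add, ha, hb, DirectSum.add_apply]
  | of j q =>
    obtain ⟨v, rfl⟩ := Submodule.mkQ_surjective _ q
    change reesQuotientCoeff K V F hF i (DirectSum.toModule K ℤ _ _ (DirectSum.lof K ℤ _ j _)) = _
    rw [DirectSum.toModule_lof]
    change Submodule.Quotient.mk _ = _
    by_cases h : j = i
    · subst h
      rw [DirectSum.of_eq_same]
      congr 1
      ext
      exact (tensorCoeff_T_tmul K V j (-j) v).trans (if_pos rfl)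
    · rw [DirectSum.of_eq_of_ne _ _ _ (Ne.symm h), ← Submodule.Quotient.mk_zero]
      congr 1
      ext
      exact (tensorCoeff_T_tmul K V i (-j) v).trans (if_neg fun h' => h (neg_injective h'))

lemma gradedToReesQuotient_injective (hF : Antitone F) :
    Function.Injective (gradedToReesQuotient K V F) := by
  intro a b hab
  refine DFinsupp.ext fun i => ?_
  rw [← reesQuotientCoeff_gradedToReesQuotient K V F hF, hab,
    reesQuotientCoeff_gradedToReesQuotient]

lemma gradedToReesQuotient_surjective (hF : Antitone F) :
    Function.Surjective (gradedToReesQuotient K V F) := by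
  intro q
  obtain ⟨⟨z, hz⟩, rfl⟩ := Submodule.mkQ_surjective _ q
  suffices h : (ReesModule K V F).restrictScalars K ≤
      ((LinearMap.range (gradedToReesQuotient K V F)).comap (reesXSmul K V F).mkQ).map
        ((ReesModule K V F).restrictScalars K).subtype by
    obtain ⟨w, hw, rfl⟩ := h hz
    exact hw
  nth_rewrite 1 [reesModule_restrictScalars_eq_span K V F hF]
  rw [Submodule.span_le]
  rintro _ ⟨i, v, hv, rfl⟩
  refine ⟨toRees K V F i ⟨v, hv⟩, ⟨DirectSum.lof K ℤ _ i (Submodule.Quotient.mk ⟨v, hv⟩), ?_⟩, rfl⟩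
  rw [gradedToReesQuotient, DirectSum.toModule_lof]
  rfl

end Rees

/-- for a finite-dimensional `V` with an antitone, exhaustive and separated
filtration `F`, the quotient `R(V,F) / (x • R(V,F))` is `K`-linearly isomorphic to the
direct sum over `i : ℤ` of the graded pieces `F i / F (i+1)`. -/
theorem reesModule_quotient_x_iso_gradedPieces
    (K : Type*) [Field K] (V : Type*) [AddCommGroup V] [Module K V] [FiniteDimensional K V]
    (F : ℤ → Submodule K V) (hF : Antitone F)
    (hexh : ∃ i : ℤ, F i = ⊤) (hsep : ∃ i : ℤ, F i = ⊥) :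
    Nonempty (
      (↥((ReesModule K V F).restrictScalars K) ⧸
          Submodule.comap ((ReesModule K V F).restrictScalars K).subtype
            ((Ideal.span {(Polynomial.X : Polynomial K)} • ReesModule K V F).restrictScalars K))
        ≃ₗ[K]
      (⨁ i : ℤ, (↥(F i) ⧸ Submodule.comap (F i).subtype (F (i + 1))))) := by
  refine ⟨LinearEquiv.ofBijective (gradedToReesQuotient K V F)
    ⟨gradedToReesQuotient_injective K V F hF, gradedToReesQuotient_surjective K V F hF⟩ |>.symm⟩
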